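/- Let f be an orientation-reversing piecewise linear homeomorphism of the circle. Then the following are equivalent: (1) f is reversible in PL(S¹) by an orientation-preserving element; (2) f is reversible by an orientation-reversing element; (3) f is strongly reversible by an orientation-reversing involution; (4) f is strongly reversible by an orientation-preserving involution. -/

import Mathlib

open Set Real Filter

/-- A function `ℝ → ℝ` is piecewise linear: its set of break points is locally
finite, and off the break points the function is locally affine. -/
def IsPLFun (f : ℝ → ℝ) : Prop :=
  ∃ B : Set ℝ, (∀ r : ℝ, (B ∩ Set.Icc (-r) r).Finite) ∧
    ∀ x ∉ B, ∃ a b : ℝ, ∀ᶠ y in nhds x, f y = a * y + b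

/-- `F : ℝ → ℝ` is a lift of the circle map `f` with degree `k`. -/
def IsLift (f : Circle → Circle) (F : ℝ → ℝ) (k : ℝ) : Prop :=
  (∀ x : ℝ, f (Circle.exp (2 * π * x)) = Circle.exp (2 * π * F x)) ∧
    ∀ x : ℝ, F (x + 1) = F x + k

/-- orientation-preserving piecewise linear homeomorphism of the circle -/
def PLplus (f : Circle ≃ₜ Circle) : Prop :=
  ∃ F : ℝ → ℝ, StrictMono F ∧ IsPLFun F ∧ IsLift f F 1

/-- orientation-reversing piecewise linear homeomorphism of the circle -/
def PLminus (f : Circle ≃ₜ Circle) : Prop :=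
  ∃ F : ℝ → ℝ, StrictAnti F ∧ IsPLFun F ∧ IsLift f F (-1)

/-- piecewise linear homeomorphism of the circle -/
def PLcirc (f : Circle ≃ₜ Circle) : Prop := PLplus f ∨ PLminus f


/-- one-sided affine germs -/
def PLGerm (f : ℝ → ℝ) : Prop :=
  ∀ c, (∃ a b : ℝ, ∀ᶠ y in nhdsWithin c (Ioi c), f y = a * y + b) ∧
    (∃ a b : ℝ, ∀ᶠ y in nhdsWithin c (Iio c), f y = a * y + b)

theorem affine_of_locally (f : ℝ → ℝ) (s : Set ℝ) (hs : IsPreconnected s)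
    (hne : s.Nonempty)
    (h : ∀ x ∈ s, ∃ a b : ℝ, ∀ᶠ y in nhds x, f y = a * y + b) :
    ∃ a b : ℝ, ∀ x ∈ s, f x = a * x + b := by
  obtain ⟨x0, hx0⟩ := hne
  obtain ⟨a, b, hab⟩ := h x0 hx0
  refine ⟨a, b, ?_⟩
  have key : s ⊆ {x | ∀ᶠ y in nhds x, f y = a * y + b} := by
    apply hs.subset_of_closure_inter_subset
    · exact isOpen_iff_mem_nhds.2 fun x hx => eventually_eventually_nhds.2 hx
    · exact ⟨x0, hx0, hab⟩
    · rintro x ⟨hx, hxs⟩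
      obtain ⟨a', b', h'⟩ := h x hxs
      obtain ⟨ε, hε, hb⟩ := Metric.eventually_nhds_iff_ball.1 h'
      obtain ⟨z, hz, hzb⟩ := mem_closure_iff_nhds.1 hx _ (Metric.ball_mem_nhds x hε)
      have hz' : ∀ᶠ y in nhds z, f y = a' * y + b' := by
        filter_upwards [Metric.isOpen_ball.mem_nhds hz] with y hy using hb y hy
      have h3 := hz'.and hzb
      have e1 := h3.self_of_nhds
      have : a' = a ∧ b' = b := by
        obtain ⟨δ, hδ, hd⟩ := Metric.eventually_nhds_iff_ball.1 h3
        have e2 := hd (z + δ / 2) (by simp [abs_of_pos hδ]; linarith)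
        have : (a' - a) * (δ / 2) = 0 := by
          linarith [e1.1, e1.2, e2.1, e2.2]
        have : a' = a := by
          rcases mul_eq_zero.1 this with h | h <;> linarith
        subst this
        exact ⟨rfl, by linarith [e1.1, e1.2]⟩
      rw [this.1, this.2] at h'
      exact h'
  intro x hx
  exact (key hx).self_of_nhds

theorem PLGerm.of_isPL {f : ℝ → ℝ} (hf : IsPLFun f) : PLGerm f := by
  obtain ⟨B, hB, h⟩ := hf
  intro c
  have hfin : (B ∩ Icc (c - 1) (c + 1)).Finite := by
    apply (hB (|c| + 1)).subset
    rintro x ⟨hx, h1, h2⟩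
    have := abs_le.1 (le_refl |c|)
    exact ⟨hx, by linarith, by linarith⟩
  have hcl : IsClosed ((B ∩ Icc (c - 1) (c + 1)) \ {c}) := (hfin.subset sdiff_subset).isClosed
  have hn : ((B ∩ Icc (c - 1) (c + 1)) \ {c})ᶜ ∈ nhds c := hcl.isOpen_compl.mem_nhds (by simp)
  obtain ⟨ε, hε, hb⟩ := Metric.mem_nhds_iff.1 hn
  have key : ∀ y, |y - c| < min ε 1 → y ≠ c → y ∉ B := by
    intro y hy hyc hyB
    have h1 := hb (show y ∈ Metric.ball c ε from by
      rw [Metric.mem_ball, Real.dist_eq]; exact hy.trans_le (min_le_left _ _))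
    apply h1
    have h2 := abs_lt.1 (hy.trans_le (min_le_right _ _))
    exact ⟨⟨hyB, by linarith, by linarith⟩, hyc⟩
  have hm : 0 < min ε 1 := by positivity
  constructor
  · obtain ⟨a, b, hab⟩ := affine_of_locally f (Ioo c (c + min ε 1)) isPreconnected_Ioo
      ⟨c + min ε 1 / 2, by constructor <;> linarith⟩
      (fun x hx => h x (key x (by rw [abs_of_pos] <;> linarith [hx.1, hx.2]) hx.1.ne'))
    refine ⟨a, b, ?_⟩
    filter_upwards [Ioo_mem_nhdsGT (show c < c + min ε 1 by linarith)] with y hy using hab y hy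
  · obtain ⟨a, b, hab⟩ := affine_of_locally f (Ioo (c - min ε 1) c) isPreconnected_Ioo
      ⟨c - min ε 1 / 2, by constructor <;> linarith⟩
      (fun x hx => h x (key x (by rw [abs_of_neg] <;> linarith [hx.1, hx.2]) hx.2.ne))
    refine ⟨a, b, ?_⟩
    filter_upwards [Ioo_mem_nhdsLT (show c - min ε 1 < c by linarith)] with y hy using hab y hy

theorem PLGerm.isPL {f : ℝ → ℝ} (hf : PLGerm f) : IsPLFun f := by
  refine ⟨{x | ¬ ∃ a b : ℝ, ∀ᶠ y in nhds x, f y = a * y + b}, ?_, ?_⟩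
  · intro r
    by_contra hinf
    obtain ⟨c, -, hc⟩ := Set.Infinite.exists_accPt_of_subset_isCompact hinf isCompact_Icc
      inter_subset_right
    rw [accPt_iff_frequently] at hc
    apply hc
    have h1 : ∀ᶠ y in nhdsWithin c (Ioi c), ∃ a b : ℝ, ∀ᶠ y in nhds y, f y = a * y + b := by
      obtain ⟨a, b, hab⟩ := (hf c).1
      filter_upwards [eventually_eventually_nhdsWithin.2 hab, self_mem_nhdsWithin] with y hy hy2
      rw [IsOpen.nhdsWithin_eq isOpen_Ioi hy2] at hy
      exact ⟨a, b, hy⟩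
    have h2 : ∀ᶠ y in nhdsWithin c (Iio c), ∃ a b : ℝ, ∀ᶠ y in nhds y, f y = a * y + b := by
      obtain ⟨a, b, hab⟩ := (hf c).2
      filter_upwards [eventually_eventually_nhdsWithin.2 hab, self_mem_nhdsWithin] with y hy hy2
      rw [IsOpen.nhdsWithin_eq isOpen_Iio hy2] at hy
      exact ⟨a, b, hy⟩
    rw [eventually_nhdsWithin_iff] at h1 h2
    filter_upwards [h1, h2] with y hy1 hy2
    rintro ⟨hne, hyb, -⟩
    rcases lt_or_gt_of_ne hne with h | h
    · exact hyb (hy2 h)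
    · exact hyb (hy1 h)
  · intro x hx
    simpa using hx

theorem tend_mono_gt {g : ℝ → ℝ} (hg : StrictMono g) (hc : Continuous g) (c : ℝ) :
    Tendsto g (nhdsWithin c (Ioi c)) (nhdsWithin (g c) (Ioi (g c))) :=
  tendsto_nhdsWithin_iff.2 ⟨hc.continuousAt.tendsto.mono_left nhdsWithin_le_nhds,
    eventually_mem_nhdsWithin.mono fun _ hy => hg hy⟩

theorem tend_mono_lt {g : ℝ → ℝ} (hg : StrictMono g) (hc : Continuous g) (c : ℝ) :
    Tendsto g (nhdsWithin c (Iio c)) (nhdsWithin (g c) (Iio (g c))) :=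
  tendsto_nhdsWithin_iff.2 ⟨hc.continuousAt.tendsto.mono_left nhdsWithin_le_nhds,
    eventually_mem_nhdsWithin.mono fun _ hy => hg hy⟩

theorem tend_anti_gt {g : ℝ → ℝ} (hg : StrictAnti g) (hc : Continuous g) (c : ℝ) :
    Tendsto g (nhdsWithin c (Ioi c)) (nhdsWithin (g c) (Iio (g c))) :=
  tendsto_nhdsWithin_iff.2 ⟨hc.continuousAt.tendsto.mono_left nhdsWithin_le_nhds,
    eventually_mem_nhdsWithin.mono fun _ hy => hg hy⟩

theorem tend_anti_lt {g : ℝ → ℝ} (hg : StrictAnti g) (hc : Continuous g) (c : ℝ) :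
    Tendsto g (nhdsWithin c (Iio c)) (nhdsWithin (g c) (Ioi (g c))) :=
  tendsto_nhdsWithin_iff.2 ⟨hc.continuousAt.tendsto.mono_left nhdsWithin_le_nhds,
    eventually_mem_nhdsWithin.mono fun _ hy => hg hy⟩

theorem comp_aux {f g : ℝ → ℝ} {l l' : Filter ℝ} (ht : Tendsto g l l')
    (h1 : ∃ a b : ℝ, ∀ᶠ y in l', f y = a * y + b) (h2 : ∃ a b : ℝ, ∀ᶠ y in l, g y = a * y + b) :
    ∃ a b : ℝ, ∀ᶠ y in l, f (g y) = a * y + b := by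
  obtain ⟨a, b, h⟩ := h1
  obtain ⟨a', b', h'⟩ := h2
  refine ⟨a * a', a * b' + b, ?_⟩
  filter_upwards [ht.eventually h, h'] with y h1 h2
  rw [h1, h2]; ring

theorem PLGerm.comp_mono {f g : ℝ → ℝ} (hf : PLGerm f) (hg : PLGerm g) (hm : StrictMono g)
    (hc : Continuous g) : PLGerm (fun x => f (g x)) := fun c =>
  ⟨comp_aux (tend_mono_gt hm hc c) (hf _).1 (hg c).1,
    comp_aux (tend_mono_lt hm hc c) (hf _).2 (hg c).2⟩

theorem PLGerm.comp_anti {f g : ℝ → ℝ} (hf : PLGerm f) (hg : PLGerm g) (hm : StrictAnti g)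
    (hc : Continuous g) : PLGerm (fun x => f (g x)) := fun c =>
  ⟨comp_aux (tend_anti_gt hm hc c) (hf _).2 (hg c).1,
    comp_aux (tend_anti_lt hm hc c) (hf _).1 (hg c).2⟩

theorem inv_aux {f g : ℝ → ℝ} {l l' : Filter ℝ} (hfg : ∀ x, f (g x) = x) (ht : Tendsto g l l')
    (hl : ∀ u, ¬ ∀ᶠ y in l, y = u)
    (h1 : ∃ a b : ℝ, ∀ᶠ y in l', f y = a * y + b) :
    ∃ a b : ℝ, ∀ᶠ y in l, g y = a * y + b := by
  obtain ⟨a, b, h⟩ := h1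
  have h2 := ht.eventually h
  have ha : a ≠ 0 := by
    rintro rfl
    apply hl b
    filter_upwards [h2] with y hy
    rw [hfg] at hy
    linarith
  refine ⟨a⁻¹, - b / a, ?_⟩
  filter_upwards [h2] with y hy
  rw [hfg] at hy
  field_simp
  linarith

theorem not_const_gt (c u : ℝ) : ¬ ∀ᶠ y in nhdsWithin c (Ioi c), y = u := by
  intro h
  obtain ⟨d, hd, h⟩ := mem_nhdsGT_iff_exists_Ioo_subset.1 h
  simp only [mem_Ioi] at hd
  have h1 := h (show c + (d - c) / 2 ∈ Ioo c d by constructor <;> linarith)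
  have h2 := h (show c + (d - c) / 3 ∈ Ioo c d by constructor <;> linarith)
  simp only [mem_ofPred_eq] at h1 h2
  linarith

theorem not_const_lt (c u : ℝ) : ¬ ∀ᶠ y in nhdsWithin c (Iio c), y = u := by
  intro h
  obtain ⟨d, hd, h⟩ := mem_nhdsLT_iff_exists_Ioo_subset.1 h
  simp only [mem_Iio] at hd
  have h1 := h (show c + (d - c) / 2 ∈ Ioo d c by constructor <;> linarith)
  have h2 := h (show c + (d - c) / 3 ∈ Ioo d c by constructor <;> linarith)
  simp only [mem_ofPred_eq] at h1 h2
  linarith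

theorem anti_symm {F : ℝ ≃ ℝ} (h : StrictAnti F) : StrictAnti F.symm := by
  intro x y hxy
  by_contra hn
  have := h.antitone (not_lt.1 hn)
  simp at this
  linarith

theorem mono_symm {F : ℝ ≃ ℝ} (h : StrictMono F) : StrictMono F.symm := by
  intro x y hxy
  by_contra hn
  have := h.monotone (not_lt.1 hn)
  simp at this
  linarith

theorem anti_cont {F : ℝ → ℝ} (h : StrictAnti F) (hs : Function.Surjective F) : Continuous F := by
  have h1 : Continuous (fun x => - F x) := by
    apply Monotone.continuous_of_surjective
    · intro x y hxy
      have := h.antitone hxy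
      simpa using this
    · intro y
      obtain ⟨x, hx⟩ := hs (-y)
      exact ⟨x, by simp [hx]⟩
  have h2 : Continuous (fun x => - (- F x)) := h1.neg
  simpa only [neg_neg] using h2

theorem PLGerm.symm_anti {F : ℝ ≃ ℝ} (hf : PLGerm F) (h : StrictAnti F) : PLGerm F.symm := fun c =>
  ⟨inv_aux F.apply_symm_apply (tend_anti_gt (anti_symm h) (anti_cont (anti_symm h) F.symm.surjective) c)
    (not_const_gt c) (hf _).2,
   inv_aux F.apply_symm_apply (tend_anti_lt (anti_symm h) (anti_cont (anti_symm h) F.symm.surjective) c)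
    (not_const_lt c) (hf _).1⟩

theorem exists_fix {F : ℝ → ℝ} (h : StrictAnti F) (hc : Continuous F) : ∃ p, F p = p := by
  have hc' : Continuous (fun x => F x - x) := by fun_prop
  have : (0 : ℝ) ∈ range (fun x => F x - x) := by
    rcases le_total 0 (F 0) with h0 | h0
    · apply mem_range_of_exists_le_of_exists_ge hc'
      · exact ⟨F 0, by have := h.antitone h0; linarith⟩
      · exact ⟨0, by simpa using h0⟩
    · apply mem_range_of_exists_le_of_exists_ge hc'
      · exact ⟨0, by simpa using h0⟩
      · exact ⟨F 0, by have := h.antitone h0; linarith⟩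
  obtain ⟨p, hp⟩ := this
  exact ⟨p, by simp only at hp; linarith⟩

theorem germ_right_fix {G : ℝ → ℝ} (hG : PLGerm G) (mG : StrictMono G) (cG : Continuous G) {c : ℝ}
    (hc : G c = c) : ∃ a : ℝ, 0 < a ∧ ∀ᶠ y in nhdsWithin c (Ioi c), G y = c + a * (y - c) := by
  obtain ⟨a, b, h⟩ := (hG c).1
  have h1 : Tendsto G (nhdsWithin c (Ioi c)) (nhds c) := by
    have := cG.continuousAt.tendsto.mono_left (nhdsWithin_le_nhds (a := c) (s := Ioi c))
    rwa [hc] at this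
  have h2 : Tendsto (fun y => a * y + b) (nhdsWithin c (Ioi c)) (nhds (a * c + b)) := by
    have : Continuous (fun y => a * y + b) := by fun_prop
    exact this.continuousAt.tendsto.mono_left nhdsWithin_le_nhds
  have h3 : c = a * c + b := tendsto_nhds_unique h1 (h2.congr' (h.mono fun y hy => hy.symm))
  have h4 : ∀ᶠ y in nhdsWithin c (Ioi c), G y = c + a * (y - c) := by
    filter_upwards [h] with y hy
    rw [hy]; linear_combination -h3
  refine ⟨a, ?_, h4⟩
  obtain ⟨y, hy, hyc⟩ := (h4.and self_mem_nhdsWithin).exists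
  have hyc : c < y := hyc
  have h5 := mG hyc
  rw [hc, hy] at h5
  by_contra hn
  nlinarith

theorem local_id {G H : ℝ → ℝ} (gG : PLGerm G) (gH : PLGerm H) (mG : StrictMono G) (mH : StrictMono H)
    (cG : Continuous G) (cH : Continuous H) (R : ∀ x, G (H (G x)) = H x) {c : ℝ}
    (hc : G c = c) (hc' : H c = c) : ∀ᶠ y in nhdsWithin c (Ioi c), G y = y := by
  obtain ⟨a, ha, h1⟩ := germ_right_fix gG mG cG hc
  obtain ⟨e, he, h2⟩ := germ_right_fix gH mH cH hc'
  have tG := tend_mono_gt mG cG c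
  have tH := tend_mono_gt mH cH c
  rw [hc] at tG
  rw [hc'] at tH
  have h3 := tG.eventually h2
  have h4 := (tH.comp tG).eventually h1
  obtain ⟨y, ⟨⟨⟨y1, y2⟩, y3⟩, y4⟩, y5⟩ :=
    ((((h1.and h2).and h3).and h4).and self_mem_nhdsWithin).exists
  have y5 : c < y := y5
  simp only [Function.comp] at y4
  rw [R, y3, y1, y2] at y4
  have h5 : (y - c) * e * ((a - 1) * (a + 1)) = 0 := by linear_combination -y4
  have h6 : a = 1 := by
    have h7 : (y - c) * e ≠ 0 := (mul_pos (by linarith) he).ne'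
    rcases mul_eq_zero.1 ((mul_eq_zero.1 h5).resolve_left h7) with h | h <;> linarith
  filter_upwards [h1] with y hy
  rw [hy, h6]; ring

theorem caseA (G H : ℝ ≃ ℝ) (mG : StrictMono G) (mH : StrictMono H) (gG : PLGerm G) (gH : PLGerm H)
    (R : ∀ x, G (H (G x)) = H x) (P : ℝ) (hP : G P = P) (hP' : H P = P) :
    ∀ x, P ≤ x → G x = x := by
  by_contra! hne
  obtain ⟨x0, hx0, hx0'⟩ := hne
  have cG : Continuous G := mG.monotone.continuous_of_surjective G.surjective
  have cH : Continuous H := mH.monotone.continuous_of_surjective H.surjective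
  set U : Set ℝ := {x | P ≤ x ∧ G x ≠ x} with hU
  have Une : U.Nonempty := ⟨x0, hx0, hx0'⟩
  have Ubd : BddBelow U := ⟨P, fun x hx => hx.1⟩
  set c := sInf U with hcdef
  have key : ∀ φ : ℝ ≃ ℝ, StrictMono φ → (∀ x, x ∈ U → φ x ∈ U) → (∀ x, x ∈ U → φ.symm x ∈ U) →
      φ c = c := by
    intro φ mφ h1 h2
    apply le_antisymm
    · apply le_csInf Une
      intro u hu
      have := mφ.monotone (csInf_le Ubd (h2 u hu))
      simpa using this
    · have : φ.symm c ≤ c := by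
        apply le_csInf Une
        intro u hu
        have := (mono_symm mφ).monotone (csInf_le Ubd (h1 u hu))
        simpa using this
      have := mφ.monotone this
      simpa using this
  have cGc : G c = c := by
    apply key G mG
    · rintro x ⟨h1, h2⟩
      exact ⟨by rw [← hP]; exact mG.monotone h1, fun h => h2 (G.injective h)⟩
    · rintro x ⟨h1, h2⟩
      have : P ≤ G.symm x := by
        have := (mono_symm mG).monotone h1
        rwa [G.symm_apply_eq.2 hP.symm] at this
      refine ⟨this, fun h => h2 ?_⟩
      have h3 := congrArg G h
      simpa using h3
  have cHc : H c = c := by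
    apply key H mH
    · rintro x ⟨h1, h2⟩
      refine ⟨by rw [← hP']; exact mH.monotone h1, fun h => h2 ?_⟩
      have h3 := R x
      exact H.injective (G.injective (h3.trans h.symm))
    · rintro x ⟨h1, h2⟩
      have : P ≤ H.symm x := by
        have := (mono_symm mH).monotone h1
        rwa [H.symm_apply_eq.2 hP'.symm] at this
      refine ⟨this, fun h => h2 ?_⟩
      have h3 := R (H.symm x)
      rw [h] at h3
      simpa using h3
  have hev := local_id gG gH mG mH cG cH R cGc cHc
  obtain ⟨d, hd, hs⟩ := mem_nhdsGT_iff_exists_Ioo_subset.1 hev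
  have : d ≤ c := by
    apply le_csInf Une
    rintro u hu
    by_contra hlt
    have h1 : c ≤ u := csInf_le Ubd hu
    rcases h1.eq_or_lt with h | h
    · exact hu.2 (h ▸ cGc)
    · exact hu.2 (hs ⟨h, not_le.1 hlt⟩)
  exact absurd hd (not_lt.2 this)

theorem orbit_id (G : ℝ ≃ ℝ) (mG : StrictMono G) (M : ℝ → ℝ) (gM : PLGerm M)
    (com : ∀ x, M (G x) = G (M x)) (r Q : ℝ) (hr : M r = r) (hlt : r < G r) (hQ : G Q = Q)
    (hrQ : r ≤ Q) : ∀ x ∈ Icc r (G r), M x = x := by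
  have su : StrictMono (fun n => G^[n] r) := mG.strictMono_iterate_of_lt_map hlt
  have bd : BddAbove (range (fun n => G^[n] r)) := by
    refine ⟨Q, ?_⟩
    rintro _ ⟨n, rfl⟩
    have := (mG.monotone.iterate n) hrQ
    rwa [Function.iterate_fixed hQ] at this
  have tb := tendsto_atTop_ciSup su.monotone bd
  set b := ⨆ n, G^[n] r with hb
  have lt_b : ∀ n, G^[n] r < b := fun n => (su (Nat.lt_succ_self n)).trans_le (le_ciSup bd (n+1))
  have comn : ∀ n x, M (G^[n] x) = G^[n] (M x) := by
    intro n x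
    exact (Function.Semiconj.iterate_right (f := M) (ga := G) (gb := G) com n) x
  obtain ⟨a, b', h⟩ := (gM b).2
  obtain ⟨d, hd, hs⟩ := mem_nhdsLT_iff_exists_Ioo_subset.1 h
  obtain ⟨N, hN⟩ := (tb.eventually (lt_mem_nhds hd)).exists
  have hN1 : d < G^[N+1] r := lt_trans hN (su (Nat.lt_succ_self N))
  have e1 : M (G^[N] r) = a * G^[N] r + b' := hs ⟨hN, lt_b N⟩
  have e2 : M (G^[N+1] r) = a * G^[N+1] r + b' := hs ⟨hN1, lt_b (N+1)⟩
  rw [comn, hr] at e1 e2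
  have h12 : G^[N] r < G^[N+1] r := su (Nat.lt_succ_self N)
  have ha : a = 1 := by
    have : (a - 1) * (G^[N+1] r - G^[N] r) = 0 := by linear_combination e1 - e2
    rcases mul_eq_zero.1 this with h | h <;> linarith
  subst ha
  intro x hx
  have i1 := (mG.monotone.iterate N) hx.1
  have i2 := (mG.monotone.iterate N) hx.2
  have i3 : G^[N] (G r) = G^[N+1] r := (Function.iterate_succ_apply G N r).symm
  have e3 : M (G^[N] x) = 1 * G^[N] x + b' :=
    hs ⟨hN.trans_le i1, (i2.trans_eq i3).trans_lt (lt_b (N+1))⟩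
  rw [comn] at e3
  apply (G.injective.iterate N)
  linarith

theorem shift_int {F : ℝ → ℝ} (F1 : ∀ x, F (x + 1) = F x - 1) (m : ℤ) (x : ℝ) :
    F (x + m) = F x - m := by
  induction m using Int.induction_on generalizing x with
  | zero => simp
  | succ i ih =>
    have := F1 (x + i)
    have := ih x
    push_cast at *
    rw [← add_assoc]; linarith
  | pred i ih =>
    have h1 := F1 (x + (-(i:ℝ) - 1))
    have h2 := ih x
    push_cast at *
    rw [show x + (-(i:ℝ) - 1) + 1 = x + -(i:ℝ) by ring] at h1
    linarith

theorem shift_symm {F : ℝ ≃ ℝ} (F1 : ∀ x, F (x + 1) = F x - 1) (x : ℝ) :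
    F.symm (x + 1) = F.symm x - 1 := by
  rw [Equiv.symm_apply_eq]
  have := F1 (F.symm x - 1)
  simp at this
  linarith

theorem caseB (F K : ℝ ≃ ℝ) (mF : StrictAnti F) (mK : StrictAnti K) (gK : PLGerm K)
    (F1 : ∀ x, F (x + 1) = F x - 1) (K1 : ∀ x, K (x + 1) = K x - 1)
    (R : ∀ x, F (K (F x)) = K x - 1) :
    ∃ T : ℝ → ℝ, StrictAnti T ∧ PLGerm T ∧ (∀ x, T (x + 1) = T x - 1) ∧ (∀ x, T (T x) = x) ∧
      ∀ x, F (T (F x)) = T x - 1 := by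
  have cF : Continuous F := anti_cont mF F.surjective
  have cK : Continuous K := anti_cont mK K.surjective
  have cK' : Continuous K.symm := anti_cont (anti_symm mK) K.symm.surjective
  have gK' : PLGerm K.symm := gK.symm_anti mK
  have Fm := shift_int F1
  have Km := shift_int K1
  have K1' := shift_symm K1
  have K'm := shift_int K1'
  have F'm := shift_int (shift_symm F1)
  have Fs : ∀ x, F (x - 1) = F x + 1 := fun x => by have := Fm (-1) x; push_cast at this; rw [sub_eq_add_neg, this]; ring
  have Ks : ∀ x, K (x - 1) = K x + 1 := fun x => by have := Km (-1) x; push_cast at this; rw [sub_eq_add_neg, this]; ring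
  have K's : ∀ x, K.symm (x - 1) = K.symm x + 1 := fun x => by
    have := K'm (-1) x; push_cast at this; rw [sub_eq_add_neg, this]; ring
  obtain ⟨P, hP⟩ := exists_fix mF cF
  obtain ⟨r, hr⟩ := exists_fix mK cK
  have hr' : K.symm r = r := by rw [Equiv.symm_apply_eq, hr]
  have hQ : F (K P) = K P - 1 := by have := R P; rwa [hP] at this
  -- positions
  have PQ : P < K P := by
    by_contra hn
    have := mF.antitone (not_lt.1 hn)
    linarith
  have Pr : P < r := by
    by_contra hn
    have := mK.antitone (not_lt.1 hn)
    linarith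
  have rQ : r < K P := by
    have := mK Pr
    linarith
  have Frr : F r < r := by
    have := mF Pr
    linarith
  have rFr : r < F r + 1 := by
    have := mF rQ
    linarith
  -- G
  set G : ℝ ≃ ℝ := F.trans F with hG
  have Gap : ∀ x, G x = F (F x) := fun x => rfl
  have mG : StrictMono G := mF.comp mF
  have comF : ∀ x, K (K (F x)) = F (K (K x)) := by
    intro x
    have h1 := R (K (F x))
    have h2 := R x
    rw [h2, Ks, F1] at h1
    linarith
  set M : ℝ → ℝ := fun x => K (K x) with hM
  have gM : PLGerm M := gK.comp_anti gK mK cK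
  have comG : ∀ x, M (G x) = G (M x) := fun x => by
    simp only [hM, Gap, comF]
  have Mr : M r = r := by simp only [hM, hr]
  have hEF : ∀ x, M x = x → M (F x) = F x := fun x hx => by
    have := comF x
    simp only [hM] at hx ⊢
    rw [this, hx]
  have hEF' : ∀ x, M (F x) = F x → M x = x := fun x hx => by
    have := comF x
    simp only [hM] at hx ⊢
    rw [this] at hx
    exact F.injective hx
  have hEm : ∀ (m : ℤ) x, M (x + m) = M x + m := fun m x => by
    simp only [hM]
    have := Km (-m) (K x)
    push_cast at this
    rw [Km, sub_eq_add_neg, this]; ring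
  have GQ : G (P + 1) = P + 1 := by rw [Gap, F1, hP, Fs, hP]
  have rP1 : r ≤ P + 1 := by
    have := mF Pr
    linarith
  have G'Q : G.symm (P + 1) = P + 1 := G.symm_apply_eq.2 GQ.symm
  have comG' : ∀ x, M (G.symm x) = G.symm (M x) := fun x => by
    rw [Equiv.eq_symm_apply, ← comG]; simp
  -- the key identity region
  have E1 : ∀ x, r ≤ x → x ≤ G r → M x = x := by
    intro x h1 h2
    rcases h1.eq_or_lt with h | h
    · rw [← h, Mr]
    · exact orbit_id G mG M gM comG r _ Mr (h.trans_le h2) GQ rP1 x ⟨h1, h2⟩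
  have E2 : ∀ x, r ≤ x → x ≤ G.symm r → M x = x := by
    intro x h1 h2
    rcases h1.eq_or_lt with h | h
    · rw [← h, Mr]
    · exact orbit_id G.symm (mono_symm mG) M gM comG' r _ Mr (h.trans_le h2) G'Q rP1 x ⟨h1, h2⟩
  have E3 : ∀ x, x ≤ r → G r ≤ x → M x = x := by
    intro x h1 h2
    have := E2 (G.symm x) (by simpa using (mono_symm mG).monotone h2) ((mono_symm mG).monotone h1)
    rw [comG'] at this
    exact G.symm.injective this
  have E4 : ∀ x, x ≤ r → G.symm r ≤ x → M x = x := by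
    intro x h1 h2
    have := E1 (G x) (by simpa using mG.monotone h2) (mG.monotone h1)
    rw [comG] at this
    exact G.injective this
  have G's : F (G.symm r) = F.symm r := by simp [hG]
  have KFr : K (F r) = F.symm r + 1 := by
    have h1 := R r
    rw [hr] at h1
    have : F (K (F r) - 1) = r := by rw [Fs, h1]; ring
    have h2 := F.symm_apply_eq.2 this.symm
    linarith
  have MFr : M (F r) = F r := hEF r Mr
  have K'Fr : K.symm (F r) = F.symm r + 1 := by
    rw [Equiv.symm_apply_eq, ← KFr]; exact MFr.symm
  -- between F r and F.symm r
  have E5 : ∀ x, F r ≤ x → x ≤ F.symm r → M x = x := by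
    intro x h1 h2
    have := E4 (F.symm x) (by simpa using (anti_symm mF).antitone h1)
      (by rw [← G's] at h2; simpa using (anti_symm mF).antitone h2)
    have := hEF _ this
    simpa using this
  have E6 : ∀ x, x ≤ F r → F.symm r ≤ x → M x = x := by
    intro x h1 h2
    have := E2 (F.symm x) (by simpa using (anti_symm mF).antitone h1)
      (by rw [← G's] at h2; simpa using (anti_symm mF).antitone h2)
    have := hEF _ this
    simpa using this
  have Em : ∀ (m : ℤ) x, M (x - m) = x - m → M x = x := by
    intro m x h
    have := hEm m (x - m)
    rw [h] at this
    simpa using this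
  have FrE : ∀ m : ℤ, M (F r + m) = F r + m := fun m => by rw [hEm, MFr]
  have rE : ∀ m : ℤ, M (r + m) = r + m := fun m => by rw [hEm, Mr]
  classical
  set S : Set ℝ := {x | ∃ m : ℤ, F r + m ≤ x ∧ x ≤ r + m} with hS
  set T : ℝ → ℝ := fun x => if x ∈ S then K x else K.symm x with hT
  have TS : ∀ x (m : ℤ), F r + m ≤ x → x ≤ r + m → T x = K x := fun x m h1 h2 =>
    if_pos ⟨m, h1, h2⟩
  have TE : ∀ x, M x = x → T x = K x := fun x hx => by
    by_cases h : x ∈ S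
    · exact if_pos h
    · have : T x = K.symm x := if_neg h
      rw [this, Equiv.symm_apply_eq]; exact hx.symm
  have TE' : ∀ x, M x = x → T x = K.symm x := fun x hx => by
    rw [TE x hx, Equiv.eq_symm_apply]; exact hx
  have TB : ∀ x (m : ℤ), r + m ≤ x → x ≤ F r + m + 1 → T x = K.symm x := by
    intro x m h1 h2
    by_cases h : x ∈ S
    · obtain ⟨j, h3, h4⟩ := h
      apply TE'
      rcases le_or_gt j m with hj | hj
      · have : (j : ℝ) ≤ m := by exact_mod_cast hj
        have : x = r + m := by linarith
        rw [this, rE]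
      · have : (m : ℝ) + 1 ≤ j := by exact_mod_cast hj
        have : x = F r + (m + 1 : ℤ) := by push_cast; linarith
        rw [this, FrE]
    · exact if_neg h
  have cover : ∀ x, (∃ m : ℤ, F r + m ≤ x ∧ x ≤ r + m) ∨ (∃ m : ℤ, r + m ≤ x ∧ x ≤ F r + m + 1) := by
    intro x
    have h1 := Int.floor_le (x - F r)
    have h2 := Int.lt_floor_add_one (x - F r)
    rcases le_total x (r + ⌊x - F r⌋) with h | h
    · exact Or.inl ⟨_, by linarith, h⟩
    · exact Or.inr ⟨_, h, by linarith⟩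
  have T1 : ∀ x, T (x + 1) = T x - 1 := by
    intro x
    rcases cover x with ⟨m, h1, h2⟩ | ⟨m, h1, h2⟩
    · rw [TS x m h1 h2, TS (x + 1) (m + 1) (by push_cast; linarith) (by push_cast; linarith), K1]
    · rw [TB x m h1 h2, TB (x + 1) (m + 1) (by push_cast; linarith) (by push_cast; linarith), K1']
  have TT : ∀ x, T (T x) = x := by
    intro x
    rcases cover x with ⟨m, h1, h2⟩ | ⟨m, h1, h2⟩
    · rw [TS x m h1 h2]
      have h3 := mK.antitone h1
      have h4 := mK.antitone h2
      rw [Km] at h3 h4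
      rw [hr] at h4
      rw [KFr] at h3
      have : T (K x) = K.symm (K x) := by
        rcases le_total (K x) (F r - m + 1) with h | h
        · exact TB _ (-m) (by push_cast; linarith) (by push_cast; linarith)
        · apply TE'
          apply Em (-m + 1)
          apply E5 <;> push_cast <;> linarith
      rw [this]; simp
    · rw [TB x m h1 h2]
      have h3 := (anti_symm mK).antitone h1
      have h4 := (anti_symm mK).antitone h2
      rw [K'm] at h3
      rw [K1', K'm, K'Fr] at h4
      rw [hr'] at h3
      have : T (K.symm x) = K (K.symm x) := by
        rcases le_total (F r - m) (K.symm x) with h | h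
        · exact TS _ (-m) (by push_cast; linarith) (by push_cast; linarith)
        · apply TE
          apply Em (-m)
          apply E6 <;> push_cast <;> linarith
      rw [this]; simp
  have R' : ∀ x, F (K.symm (F x)) = K.symm x - 1 := by
    intro x
    -- K F y = F.symm (K y - 1)
    have h5 : ∀ y, K (F y) = F.symm (K y - 1) := fun y => by rw [Equiv.eq_symm_apply, R]
    rw [← K.injective.eq_iff, h5]
    have h6 : K (K.symm x - 1) = x + 1 := by rw [Ks]; simp
    rw [h6]
    simp only [Equiv.apply_symm_apply]
    rw [Equiv.symm_apply_eq, F1]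
  have RT : ∀ x, F (T (F x)) = T x - 1 := by
    intro x
    rcases cover x with ⟨m, h1, h2⟩ | ⟨m, h1, h2⟩
    · rw [TS x m h1 h2]
      have h3 := mF.antitone h1
      have h4 := mF.antitone h2
      rw [Fm] at h3 h4
      have : T (F x) = K (F x) := by
        rcases le_total (F x) (r - m) with h | h
        · exact TS _ (-m) (by push_cast; linarith) (by push_cast; linarith)
        · apply TE
          apply Em (-m)
          apply E1 <;> push_cast <;> linarith [Gap r]
      rw [this, R]
    · rw [TB x m h1 h2]
      have h3 := mF.antitone h1
      have h4 := mF.antitone h2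
      rw [Fm] at h3
      rw [F1, Fm] at h4
      have : T (F x) = K.symm (F x) := by
        rcases le_total (r - m - 1) (F x) with h | h
        · exact TB _ (-m - 1) (by push_cast; linarith) (by push_cast; linarith)
        · apply TE'
          apply Em (-m - 1)
          apply E3 <;> push_cast <;> linarith [Gap r]
      rw [this, R']
  have locR : ∀ c, (∀ᶠ y in nhdsWithin c (Ici c), T y = K y) ∨
      (∀ᶠ y in nhdsWithin c (Ici c), T y = K.symm y) := by
    intro c
    have h1 := Int.floor_le (c - F r)
    have h2 := Int.lt_floor_add_one (c - F r)
    set m := ⌊c - F r⌋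
    rcases lt_or_ge c (r + m) with h | h
    · left
      filter_upwards [Icc_mem_nhdsGE h] with y hy
      exact TS y m (by linarith [hy.1]) hy.2
    · right
      filter_upwards [Icc_mem_nhdsGE (show c < F r + m + 1 by linarith)] with y hy
      exact TB y m (by linarith [hy.1]) hy.2
  have locL : ∀ c, (∀ᶠ y in nhdsWithin c (Iic c), T y = K y) ∨
      (∀ᶠ y in nhdsWithin c (Iic c), T y = K.symm y) := by
    intro c
    have h1 := Int.ceil_lt_add_one (c - F r)
    have h2 := Int.le_ceil (c - F r)
    set m := ⌈c - F r⌉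
    rcases le_or_gt c (r + m - 1) with h | h
    · left
      filter_upwards [Icc_mem_nhdsLE (show F r + m - 1 < c by linarith)] with y hy
      exact TS y (m - 1) (by push_cast; linarith [hy.1]) (by push_cast; linarith [hy.2])
    · right
      filter_upwards [Icc_mem_nhdsLE h] with y hy
      exact TB y (m - 1) (by push_cast; linarith [hy.1]) (by push_cast; linarith [hy.2])
  have cT : Continuous T := by
    rw [continuous_iff_continuousAt]
    intro c
    rw [continuousAt_iff_continuous_left_right]
    constructor
    · rcases locL c with h | h
      · exact cK.continuousWithinAt.congr_of_eventuallyEq_of_mem h self_mem_Iic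
      · exact cK'.continuousWithinAt.congr_of_eventuallyEq_of_mem h self_mem_Iic
    · rcases locR c with h | h
      · exact cK.continuousWithinAt.congr_of_eventuallyEq_of_mem h self_mem_Ici
      · exact cK'.continuousWithinAt.congr_of_eventuallyEq_of_mem h self_mem_Ici
  have gT : PLGerm T := by
    intro c
    have aux : ∀ {l : Filter ℝ} {g : ℝ → ℝ}, (∀ᶠ y in l, T y = g y) →
        (∃ a b : ℝ, ∀ᶠ y in l, g y = a * y + b) → ∃ a b : ℝ, ∀ᶠ y in l, T y = a * y + b := by
      rintro l g h ⟨a, b, h'⟩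
      exact ⟨a, b, by filter_upwards [h, h'] with y h1 h2; rw [h1, h2]⟩
    constructor
    · rcases locR c with h | h
      · exact aux (h.filter_mono (nhdsWithin_mono _ Ioi_subset_Ici_self)) (gK c).1
      · exact aux (h.filter_mono (nhdsWithin_mono _ Ioi_subset_Ici_self)) (gK' c).1
    · rcases locL c with h | h
      · exact aux (h.filter_mono (nhdsWithin_mono _ Iio_subset_Iic_self)) (gK c).2
      · exact aux (h.filter_mono (nhdsWithin_mono _ Iio_subset_Iic_self)) (gK' c).2
  have mT : StrictAnti T := by
    have inj : Function.Injective T := Function.LeftInverse.injective TT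
    rcases cT.strictMono_of_inj inj with h | h
    · exfalso
      have h1 := h (show (0:ℝ) < 0 + 1 by norm_num)
      rw [T1] at h1
      linarith
    · exact h
  exact ⟨T, mT, gT, T1, TT, RT⟩

noncomputable def ex (x : ℝ) : Circle := Circle.exp (2 * π * x)

theorem ex_eq {x y : ℝ} : ex x = ex y ↔ ∃ m : ℤ, x = y + m := by
  unfold ex
  rw [Circle.exp_eq_exp]
  have := Real.pi_pos
  constructor
  · rintro ⟨m, hm⟩
    refine ⟨m, ?_⟩
    have : (2 * π) * (x - (y + m)) = 0 := by linear_combination hm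
    rcases mul_eq_zero.1 this with h | h <;> linarith
  · rintro ⟨m, rfl⟩
    exact ⟨m, by ring⟩

theorem ex_surj (z : Circle) : ∃ x, ex x = z := by
  obtain ⟨t, rfl⟩ := Circle.exp_surjective z
  refine ⟨t / (2 * π), ?_⟩
  unfold ex
  congr 1
  field_simp

theorem ex_quot : Topology.IsQuotientMap ex := by
  have h1 : IsOpenMap ex := by
    have h2 : IsOpenMap (fun x : ℝ => 2 * π * x) :=
      (Homeomorph.mulLeft₀ (2 * π) (by positivity)).isOpenMap
    exact isLocalHomeomorph_circleExp.isOpenMap.comp h2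
  exact h1.isQuotientMap (by unfold ex; fun_prop) ex_surj

theorem lift_surj {f : Circle ≃ₜ Circle} {F : ℝ → ℝ} {k : ℝ} (hk : k = 1 ∨ k = -1)
    (h : IsLift f F k) : Function.Surjective F := by
  have hm : ∀ (m : ℤ) x, F (x + m) = F x + k * m := by
    intro m x
    induction m using Int.induction_on generalizing x with
    | zero => simp
    | succ i ih =>
      have h1 := h.2 (x + i)
      have h2 := ih x
      push_cast at *
      rw [← add_assoc]; linarith
    | pred i ih =>
      have h1 := h.2 (x + (-(i:ℝ) - 1))
      have h2 := ih x
      push_cast at *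
      rw [show x + (-(i:ℝ) - 1) + 1 = x + -(i:ℝ) by ring] at h1
      linarith
  intro y
  obtain ⟨z, hz⟩ := f.surjective (ex y)
  obtain ⟨x, rfl⟩ := ex_surj z
  have h1 : f (ex x) = ex (F x) := h.1 x
  rw [h1] at hz
  obtain ⟨m, hm'⟩ := ex_eq.1 hz
  rcases hk with rfl | rfl
  · exact ⟨x + (-m : ℤ), by rw [hm]; push_cast; linarith⟩
  · exact ⟨x + (m : ℤ), by rw [hm]; linarith⟩

theorem plus_data {f : Circle ≃ₜ Circle} (hf : PLplus f) : ∃ F : ℝ ≃ ℝ, StrictMono F ∧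
    Continuous F ∧ PLGerm F ∧ (∀ x, F (x + 1) = F x + 1) ∧ ∀ x, f (ex x) = ex (F x) := by
  obtain ⟨F, h1, h2, h3⟩ := hf
  have hs := lift_surj (Or.inl rfl) h3
  exact ⟨Equiv.ofBijective F ⟨h1.injective, hs⟩, h1, h1.monotone.continuous_of_surjective hs,
    PLGerm.of_isPL h2, h3.2, h3.1⟩

theorem minus_data {f : Circle ≃ₜ Circle} (hf : PLminus f) : ∃ F : ℝ ≃ ℝ, StrictAnti F ∧
    Continuous F ∧ PLGerm F ∧ (∀ x, F (x + 1) = F x - 1) ∧ ∀ x, f (ex x) = ex (F x) := by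
  obtain ⟨F, h1, h2, h3⟩ := hf
  have hs := lift_surj (Or.inr rfl) h3
  exact ⟨Equiv.ofBijective F ⟨h1.injective, hs⟩, h1, anti_cont h1 hs,
    PLGerm.of_isPL h2, fun x => (h3.2 x).trans (sub_eq_add_neg _ _).symm, h3.1⟩

theorem comp_pm {f h : Circle ≃ₜ Circle} (hf : PLminus f) (hh : PLplus h) :
    PLminus (f.trans h) := by
  obtain ⟨F, mF, cF, gF, F1, Fl⟩ := minus_data hf
  obtain ⟨H, mH, cH, gH, H1, Hl⟩ := plus_data hh
  refine ⟨fun x => H (F x), mH.comp_strictAnti mF, (gH.comp_anti gF mF cF).isPL, ?_, ?_⟩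
  · intro x
    have h1 : h (f (ex x)) = ex (H (F x)) := by rw [Fl, Hl]
    exact h1
  · intro x
    have := H1 (F x - 1)
    simp only [F1]
    simp only [sub_add_cancel] at this
    linarith

theorem comp_mm {f h : Circle ≃ₜ Circle} (hf : PLminus f) (hh : PLminus h) :
    PLplus (f.trans h) := by
  obtain ⟨F, mF, cF, gF, F1, Fl⟩ := minus_data hf
  obtain ⟨H, mH, cH, gH, H1, Hl⟩ := minus_data hh
  refine ⟨fun x => H (F x), mH.comp mF, (gH.comp_anti gF mF cF).isPL, ?_, ?_⟩
  · intro x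
    have h1 : h (f (ex x)) = ex (H (F x)) := by rw [Fl, Hl]
    exact h1
  · intro x
    have := H1 (F x - 1)
    simp only [F1]
    simp only [sub_add_cancel] at this
    linarith

theorem int_const {u : ℝ → ℝ} (hu : Continuous u) (h : ∀ x, ∃ n : ℤ, u x = n) :
    ∃ n : ℤ, ∀ x, u x = n := by
  choose v hv using h
  have hv' : u = fun x => (v x : ℝ) := funext hv
  have cv : Continuous v := by
    rw [Int.isClosedEmbedding_coe_real.isInducing.continuous_iff]
    rw [hv'] at hu
    exact hu
  refine ⟨v 0, fun x => ?_⟩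
  rw [hv x, PreconnectedSpace.constant inferInstance cv (x := x) (y := 0)]

theorem main_dir (f : Circle ≃ₜ Circle) (hf : PLminus f)
    (hex : ∃ h : Circle ≃ₜ Circle, PLplus h ∧ ∀ z : Circle, f (h (f z)) = h z) :
    ∃ τ : Circle ≃ₜ Circle, PLminus τ ∧ (∀ z : Circle, τ (τ z) = z) ∧
        ∀ z : Circle, f (τ (f z)) = τ z := by
  obtain ⟨h, hh, R⟩ := hex
  obtain ⟨F, mF, cF, gF, F1, Fl⟩ := minus_data hf
  obtain ⟨H, mH, cH, gH, H1, Hl⟩ := plus_data hh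
  obtain ⟨n, hn⟩ : ∃ n : ℤ, ∀ x, F (H (F x)) - H x = n := by
    apply int_const (u := fun x => F (H (F x)) - H x) (by fun_prop)
    intro x
    have h1 := R (ex x)
    rw [Fl, Hl, Fl, Hl] at h1
    obtain ⟨m, hm⟩ := ex_eq.1 h1
    exact ⟨m, by linarith⟩
  have Fm := shift_int F1
  obtain ⟨j, hj | hj⟩ := Int.even_or_odd' n
  · -- the lift of `f` squares to the identity
    let H' : ℝ ≃ ℝ := H.trans (Equiv.addRight (j : ℝ))
    have H'a : ∀ x, H' x = H x + j := fun x => rfl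
    have mH' : StrictMono H' := fun x y hxy => by
      rw [H'a, H'a]; have := mH hxy; linarith
    have gH' : PLGerm H' := by
      intro c
      obtain ⟨⟨a, b, h1⟩, ⟨a', b', h2⟩⟩ := gH c
      exact ⟨⟨a, b + j, h1.mono fun y hy => by rw [H'a, hy]; ring⟩,
        ⟨a', b' + j, h2.mono fun y hy => by rw [H'a, hy]; ring⟩⟩
    have R' : ∀ x, F (H' (F x)) = H' x := by
      intro x
      have h1 := hn x
      rw [H'a, H'a, Fm]
      have : (n : ℝ) = 2 * j := by exact_mod_cast hj
      linarith
    obtain ⟨P, hP⟩ := exists_fix mF cF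
    have hP' : H' P = P := by
      have h1 := R' P
      rw [hP] at h1
      rcases lt_trichotomy (H' P) P with h | h | h
      · have := mF h; linarith
      · exact h
      · have := mF h; linarith
    have key := caseA (F.trans F) H' (mF.comp mF) mH' (gF.comp_anti gF mF cF) gH'
      (fun x => by simp only [Equiv.trans_apply]; rw [R', R']) P (by simp [hP]) hP'
    have ff : ∀ z, f (f z) = z := by
      intro z
      obtain ⟨x, rfl⟩ := ex_surj z
      have hx : ex x = ex (x + ⌈P - x⌉) := (ex_eq.2 ⟨_, rfl⟩).symm
      rw [hx, Fl, Fl]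
      congr 1
      exact key _ (by linarith [Int.le_ceil (P - x)])
    exact ⟨f, hf, ff, fun z => ff _⟩
  · let K : ℝ ≃ ℝ := F.trans (H.trans (Equiv.addRight ((j : ℝ) + 1)))
    have Ka : ∀ x, K x = H (F x) + j + 1 := fun x => by simp [K, add_assoc]
    have mK : StrictAnti K := fun x y hxy => by
      rw [Ka, Ka]; have := mH (mF hxy); linarith
    have gK : PLGerm K := by
      intro c
      obtain ⟨⟨a, b, h1⟩, ⟨a', b', h2⟩⟩ := (gH.comp_anti gF mF cF) c
      exact ⟨⟨a, b + j + 1, h1.mono fun y hy => by beta_reduce at hy; rw [Ka, hy]; ring⟩,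
        ⟨a', b' + j + 1, h2.mono fun y hy => by beta_reduce at hy; rw [Ka, hy]; ring⟩⟩
    have K1 : ∀ x, K (x + 1) = K x - 1 := by
      intro x
      have := H1 (F x - 1)
      simp only [sub_add_cancel] at this
      rw [Ka, Ka, F1]; linarith
    have R' : ∀ x, F (K (F x)) = K x - 1 := by
      intro x
      have h1 := hn (F x)
      have h2 := Fm (j + 1) (H (F (F x)))
      push_cast at h2
      rw [Ka, Ka, add_assoc, h2]
      have : (n : ℝ) = 2 * j + 1 := by exact_mod_cast hj
      linarith
    obtain ⟨T, mT, gT, T1, TT, RT⟩ := caseB F K mF mK gK F1 K1 R'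
    have Tm := shift_int T1
    choose s hs using ex_surj
    obtain ⟨t, tl⟩ : ∃ t : Circle → Circle, ∀ x, t (ex x) = ex (T x) := by
      refine ⟨fun z => ex (T (s z)), fun x => ?_⟩
      obtain ⟨m, hm⟩ := ex_eq.1 (hs (ex x))
      change ex (T (s (ex x))) = _
      rw [hm, Tm]
      exact ex_eq.2 ⟨-m, by push_cast; ring⟩
    have ct : Continuous t := by
      rw [ex_quot.continuous_iff]
      have : t ∘ ex = ex ∘ T := funext tl
      rw [this]
      exact ex_quot.continuous.comp (anti_cont mT (fun y => ⟨T y, TT y⟩))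
    have tt : ∀ z, t (t z) = z := by
      intro z
      obtain ⟨x, rfl⟩ := ex_surj z
      rw [tl, tl, TT]
    let τ : Circle ≃ₜ Circle :=
      { toFun := t, invFun := t, left_inv := tt, right_inv := tt,
        continuous_toFun := ct, continuous_invFun := ct }
    refine ⟨τ, ⟨T, mT, gT.isPL, tl, fun x => by rw [T1]; ring⟩, tt, ?_⟩
    intro z
    obtain ⟨x, rfl⟩ := ex_surj z
    change f (t (f (ex x))) = t (ex x)
    rw [Fl, tl, Fl, tl, RT]
    exact ex_eq.2 ⟨-1, by push_cast; ring⟩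

/-- Let `f ∈ PL⁻(S¹)`.  The following are equivalent:
(1) `f` is reversible in `PL(S¹)` by an orientation-preserving element;
(2) `f` is reversible by an orientation-reversing element;
(3) `f` is strongly reversible by an orientation-reversing involution;
(4) `f` is strongly reversible by an orientation-preserving involution.
(Reversibility `h f h⁻¹ = f⁻¹` is expressed inverse-free as `f ∘ h ∘ f = h`.) -/
theorem PLminus_reversibility_tfae (f : Circle ≃ₜ Circle) (hf : PLminus f) :
    ((∃ h : Circle ≃ₜ Circle, PLplus h ∧ ∀ z : Circle, f (h (f z)) = h z) ↔
      (∃ h : Circle ≃ₜ Circle, PLminus h ∧ ∀ z : Circle, f (h (f z)) = h z)) ∧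
    ((∃ h : Circle ≃ₜ Circle, PLminus h ∧ ∀ z : Circle, f (h (f z)) = h z) ↔
      (∃ τ : Circle ≃ₜ Circle, PLminus τ ∧ (∀ z : Circle, τ (τ z) = z) ∧
        ∀ z : Circle, f (τ (f z)) = τ z)) ∧
    ((∃ τ : Circle ≃ₜ Circle, PLminus τ ∧ (∀ z : Circle, τ (τ z) = z) ∧
        ∀ z : Circle, f (τ (f z)) = τ z) ↔
      (∃ τ : Circle ≃ₜ Circle, PLplus τ ∧ (∀ z : Circle, τ (τ z) = z) ∧
        ∀ z : Circle, f (τ (f z)) = τ z)) := by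
  have h12 : (∃ h : Circle ≃ₜ Circle, PLplus h ∧ ∀ z : Circle, f (h (f z)) = h z) →
      (∃ h : Circle ≃ₜ Circle, PLminus h ∧ ∀ z : Circle, f (h (f z)) = h z) :=
    fun ⟨h, hh, R⟩ => ⟨f.trans h, comp_pm hf hh, fun z => R (f z)⟩
  have h21 : (∃ h : Circle ≃ₜ Circle, PLminus h ∧ ∀ z : Circle, f (h (f z)) = h z) →
      (∃ h : Circle ≃ₜ Circle, PLplus h ∧ ∀ z : Circle, f (h (f z)) = h z) :=
    fun ⟨h, hh, R⟩ => ⟨f.trans h, comp_mm hf hh, fun z => R (f z)⟩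
  refine ⟨⟨h12, h21⟩, ⟨fun h => main_dir f hf (h21 h), fun ⟨τ, h1, _, h3⟩ => ⟨τ, h1, h3⟩⟩, ?_, ?_⟩
  · rintro ⟨τ, h1, h2, h3⟩
    refine ⟨f.trans τ, comp_mm hf h1, fun z => ?_, fun z => h3 (f z)⟩
    change τ (f (τ (f z))) = z
    rw [h3, h2]
  · rintro ⟨τ, h1, h2, h3⟩
    refine ⟨f.trans τ, comp_pm hf h1, fun z => ?_, fun z => h3 (f z)⟩
    change τ (f (τ (f z))) = z
    rw [h3, h2]
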